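/- arXiv:2301.08137 — 3 statements merged into one kernel-verified Lean document; each statement's English description precedes it below -/
import Mathlib

section
/- Let (S, P) be a finite Markov chain and r : S → ℝ a reward function. For every state s ∈ S, the expected mean payoff equals the reward averaged by the stationary distribution: E_{ℙ_s}[ liminf_{n→∞} (1/n) Σ_{i=1}^n r(ω(i)) ] = Σ_{s'∈S} π_s(s') · r(s'). -/
open Finset Filter Topology MeasureTheory

/-- `P` is a row-stochastic transition matrix. -/
def IsStochastic {S : Type*} [Fintype S] (P : Matrix S S ℝ) : Prop :=
  (∀ s s', 0 ≤ P s s') ∧ ∀ s, ∑ s', P s s' = 1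

section LinearAlgebra

variable {S : Type*} [Fintype S]

lemma IsStochastic.abs_mulVec_le {P : Matrix S S ℝ} (hP : IsStochastic P) {f : S → ℝ} {C : ℝ}
    (hf : ∀ s, |f s| ≤ C) (s : S) : |(P.mulVec f) s| ≤ C := by
  calc |∑ t, P s t * f t| ≤ ∑ t, |P s t * f t| := abs_sum_le_sum_abs _ _
    _ ≤ ∑ t, P s t * C := by
        refine sum_le_sum fun t _ => ?_
        rw [abs_mul, abs_of_nonneg (hP.1 s t)]
        exact mul_le_mul_of_nonneg_left (hf t) (hP.1 s t)
    _ = C := by rw [← sum_mul, hP.2, one_mul]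

lemma exists_forall_abs_le (f : S → ℝ) : ∃ C, 0 ≤ C ∧ ∀ s, |f s| ≤ C :=
  ⟨∑ s, |f s|, sum_nonneg fun _ _ => abs_nonneg _,
    fun s => single_le_sum (f := fun s => |f s|) (fun _ _ => abs_nonneg _) (mem_univ s)⟩

/-- A harmonic function in the range of `1 - P` vanishes. -/
lemma IsStochastic.eq_zero_of_harmonic_of_mem_range {P : Matrix S S ℝ} (hP : IsStochastic P)
    {u v : S → ℝ} (hu : u - P.mulVec u = v) (hv : P.mulVec v = v) : v = 0 := by
  classical
  obtain ⟨C, -, hC⟩ := exists_forall_abs_le u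
  have hiter : ∀ n : ℕ, ∃ w : S → ℝ, (∀ s, |w s| ≤ C) ∧ u - w = (n : ℝ) • v ∧
      w - P.mulVec w = v := by
    intro n
    induction n with
    | zero => exact ⟨u, hC, by simp, hu⟩
    | succ n ih =>
      obtain ⟨w, hw, hsum, hstep⟩ := ih
      refine ⟨P.mulVec w, hP.abs_mulVec_le hw, ?_, ?_⟩
      · push_cast
        rw [add_smul, one_smul, ← hsum, ← hstep]
        abel
      · rw [← Matrix.mulVec_sub, hstep, hv]
  ext s
  by_contra hne
  have hpos : 0 < |v s| := abs_pos.mpr hne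
  obtain ⟨n, hn⟩ := exists_nat_gt (2 * C / |v s|)
  rw [div_lt_iff₀ hpos] at hn
  obtain ⟨w, hw, hsum, -⟩ := hiter n
  have h1 : u s - w s = n * v s := congrFun hsum s
  have h2 : |u s - w s| = n * |v s| := by rw [h1, abs_mul, Nat.abs_cast]
  have h3 := abs_sub (u s) (w s)
  linarith [hC s, hw s]

/-- Every function is the sum of a harmonic function and a function of the form `g - P g`. -/
lemma IsStochastic.exists_poisson_decomposition {P : Matrix S S ℝ} (hP : IsStochastic P)
    (r : S → ℝ) : ∃ h g : S → ℝ, P.mulVec h = h ∧ r = h + (g - P.mulVec g) := by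
  let A : (S → ℝ) →ₗ[ℝ] (S → ℝ) := LinearMap.id - P.mulVecLin
  have hA : ∀ x, A x = x - P.mulVec x := fun x => rfl
  have hdisj : Disjoint (LinearMap.ker A) (LinearMap.range A) := by
    rw [Submodule.disjoint_def]
    rintro v hv ⟨u, hu⟩
    rw [LinearMap.mem_ker, hA, sub_eq_zero] at hv
    exact hP.eq_zero_of_harmonic_of_mem_range ((hA u).symm.trans hu) hv.symm
  have htop : LinearMap.ker A ⊔ LinearMap.range A = ⊤ := by
    refine Submodule.eq_top_of_disjoint _ _ ?_ hdisj
    rw [add_comm, LinearMap.finrank_range_add_finrank_ker]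
  obtain ⟨h, hh, v, ⟨g, rfl⟩, hr⟩ :=
    Submodule.mem_sup.mp (htop ▸ Submodule.mem_top : r ∈ LinearMap.ker A ⊔ LinearMap.range A)
  rw [LinearMap.mem_ker, hA, sub_eq_zero] at hh
  exact ⟨h, g, hh.symm, hr.symm⟩

end LinearAlgebra

lemma ae_tendsto_zero_of_summable_integral {Ω : Type*} [MeasurableSpace Ω] {ν : Measure Ω}
    {f : ℕ → Ω → ℝ} (hf : ∀ n, Integrable (f n) ν) (hnonneg : ∀ n ω, 0 ≤ f n ω)
    (hsum : Summable fun n => ∫ ω, f n ω ∂ν) :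
    ∀ᵐ ω ∂ν, Tendsto (fun n => f n ω) atTop (𝓝 0) := by
  have hmeas : ∀ n, AEMeasurable (fun ω => ENNReal.ofReal (f n ω)) ν :=
    fun n => (hf n).aestronglyMeasurable.aemeasurable.ennreal_ofReal
  have hfin : ∫⁻ ω, ∑' n, ENNReal.ofReal (f n ω) ∂ν ≠ ⊤ := by
    rw [lintegral_tsum hmeas]
    simp_rw [← ofReal_integral_eq_lintegral_ofReal (hf _) (ae_of_all _ (hnonneg _))]
    exact hsum.tsum_ofReal_ne_top
  filter_upwards [ae_lt_top' (AEMeasurable.tsum hmeas) hfin] with ω hω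
  have h := ENNReal.tendsto_atTop_zero_of_tsum_ne_top hω.ne
  have h' := (ENNReal.tendsto_toReal ENNReal.zero_ne_top).comp h
  simpa [Function.comp_def, ENNReal.toReal_ofReal (hnonneg _ ω)] using h'

/-- A sequence with bounded increments which is sublinear along the squares is sublinear. -/
lemma tendsto_div_zero_of_tendsto_along_squares {u : ℕ → ℝ} {K : ℝ}
    (hu : ∀ n, |u (n + 1) - u n| ≤ K)
    (hsq : Tendsto (fun k : ℕ => u ((k + 1) ^ 2) / ((k + 1) ^ 2 : ℕ)) atTop (𝓝 0)) :
    Tendsto (fun n : ℕ => u n / n) atTop (𝓝 0) := by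
  have hmain : Tendsto (fun n : ℕ => (u n + K * n) / n) atTop (𝓝 K) := by
    refine tendsto_div_of_monotone_of_exists_subseq_tendsto_div _ K ?_ fun a ha => ?_
    · refine monotone_nat_of_le_succ fun n => ?_
      push_cast
      linarith [(abs_le.mp (hu n)).1]
    · refine ⟨fun k => (k + 1) ^ 2, ?_, ?_, ?_⟩
      · have hlim : Tendsto (fun k : ℕ => (1 + 1 / ((k : ℝ) + 1)) ^ 2) atTop (𝓝 1) := by
          simpa using (tendsto_one_div_add_atTop_nhds_zero_nat (𝕜 := ℝ)).const_add 1 |>.pow 2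
        filter_upwards [hlim.eventually_le_const ha] with k hk
        have hk0 : (0 : ℝ) < (k : ℝ) + 1 := by positivity
        push_cast
        calc ((k : ℝ) + 1 + 1) ^ 2 = (1 + 1 / ((k : ℝ) + 1)) ^ 2 * ((k : ℝ) + 1) ^ 2 := by
              field_simp
          _ ≤ a * ((k : ℝ) + 1) ^ 2 := by gcongr
      · exact (tendsto_pow_atTop two_ne_zero).comp (tendsto_add_atTop_nat 1)
      · have := hsq.add_const K
        rw [zero_add] at this
        refine this.congr fun k => ?_
        have : (((k + 1) ^ 2 : ℕ) : ℝ) ≠ 0 := by positivity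
        field_simp
  have := hmain.sub_const K
  rw [sub_self] at this
  refine this.congr' ?_
  filter_upwards [eventually_ne_atTop 0] with n hn
  have : (n : ℝ) ≠ 0 := by exact_mod_cast hn
  field_simp
  ring

lemma sum_Icc_one_eq_sum_range {M : Type*} [AddCommMonoid M] (f : ℕ → M) (n : ℕ) :
    ∑ i ∈ Finset.Icc 1 n, f i = ∑ i ∈ Finset.range n, f (i + 1) := by
  induction n with
  | zero => simp
  | succ n ih => rw [Finset.sum_Icc_succ_top (by omega), ih, Finset.sum_range_succ]

section Trajectories

/-- `X` depends only on the coordinates up to time `n`. -/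
def AdaptedAt {S : Type*} (n : ℕ) (X : (ℕ → S) → ℝ) : Prop :=
  ∀ ω ω' : ℕ → S, (∀ i ≤ n, ω i = ω' i) → X ω = X ω'

variable {S : Type*} [MeasurableSpace S]

/-- The law of the trajectory of a Markov chain, as prescribed on cylinder sets. -/
def IsTrajectoryLaw [DecidableEq S] (P : Matrix S S ℝ) (ν : Measure (ℕ → S)) (s : S) : Prop :=
  ∀ (n : ℕ) (w : ℕ → S), ν {ω | ∀ i ≤ n, ω i = w i} =
    (if w 0 = s then 1 else 0) * ∏ i ∈ Finset.range n, ENNReal.ofReal (P (w i) (w (i + 1)))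

lemma IsTrajectoryLaw.measureReal_cylinder_inter [Fintype S] [DecidableEq S]
    {P : Matrix S S ℝ} {ν : Measure (ℕ → S)} {s : S} (hν : IsTrajectoryLaw P ν s)
    (hP : IsStochastic P) (n : ℕ) (w : ℕ → S) (t : S) :
    ν.real ({ω | ∀ i ≤ n, ω i = w i} ∩ {ω | ω (n + 1) = t}) =
      ν.real {ω | ∀ i ≤ n, ω i = w i} * P (w n) t := by
  have hset : {ω : ℕ → S | ∀ i ≤ n, ω i = w i} ∩ {ω | ω (n + 1) = t} =
      {ω | ∀ i ≤ n + 1, ω i = Function.update w (n + 1) t i} := by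
    ext ω
    constructor
    · rintro ⟨h1, h2⟩ i hi
      rcases Nat.le_succ_iff.mp hi with h | rfl
      · rw [Function.update_of_ne (by omega), h1 i h]
      · simpa using h2
    · intro h
      refine ⟨fun i hi => ?_, by simpa using h (n + 1) le_rfl⟩
      have := h i (by omega)
      rwa [Function.update_of_ne (by omega)] at this
  have hprod : ∏ i ∈ Finset.range n, ENNReal.ofReal
      (P (Function.update w (n + 1) t i) (Function.update w (n + 1) t (i + 1))) =
      ∏ i ∈ Finset.range n, ENNReal.ofReal (P (w i) (w (i + 1))) := by
    refine Finset.prod_congr rfl fun i hi => ?_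
    have := Finset.mem_range.mp hi
    rw [Function.update_of_ne (by omega), Function.update_of_ne (by omega)]
  rw [hset, measureReal_def, hν, Finset.prod_range_succ, hprod, Function.update_self,
    Function.update_of_ne (by omega), Function.update_of_ne (by omega), ← mul_assoc, ← hν,
    ENNReal.toReal_mul, ENNReal.toReal_ofReal (hP.1 _ _), measureReal_def]

variable [MeasurableSingletonClass S]

lemma measurableSet_eval_eq (n : ℕ) (t : S) : MeasurableSet {ω : ℕ → S | ω n = t} :=
  (measurable_pi_apply n : Measurable fun ω : ℕ → S => ω n) (measurableSet_singleton t)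

lemma measurableSet_cylinder_le (n : ℕ) (w : ℕ → S) :
    MeasurableSet {ω : ℕ → S | ∀ i ≤ n, ω i = w i} := by
  have : {ω : ℕ → S | ∀ i ≤ n, ω i = w i} = ⋂ i ∈ Set.Iic n, (fun ω => ω i) ⁻¹' {w i} := by
    ext ω; simp
  rw [this]
  exact .biInter (Set.to_countable _) fun i _ =>
    measurable_pi_apply i (measurableSet_singleton (w i))

variable [Fintype S]

lemma measurable_comp_eval (f : S → ℝ) (n : ℕ) : Measurable fun ω : ℕ → S => f (ω n) :=
  (measurable_of_finite f).comp (measurable_pi_apply n)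

lemma integrable_comp_eval {ν : Measure (ℕ → S)} [IsFiniteMeasure ν] (f : S → ℝ) (n : ℕ) :
    Integrable (fun ω : ℕ → S => f (ω n)) ν := by
  obtain ⟨C, -, hC⟩ := exists_forall_abs_le f
  exact .of_bound (measurable_comp_eval f n).aestronglyMeasurable C (ae_of_all _ fun ω => hC _)

variable [DecidableEq S] {P : Matrix S S ℝ} {ν : Measure (ℕ → S)} {s : S}

lemma IsTrajectoryLaw.setIntegral_cylinder [IsProbabilityMeasure ν] (hν : IsTrajectoryLaw P ν s)
    (hP : IsStochastic P) (g : S → ℝ) (n : ℕ) (w : ℕ → S) :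
    ∫ ω in {ω | ∀ i ≤ n, ω i = w i}, (g (ω (n + 1)) - (P.mulVec g) (ω n)) ∂ν = 0 := by
  rw [integral_sub (integrable_comp_eval g _).integrableOn
    (integrable_comp_eval (P.mulVec g) _).integrableOn]
  have h1 : ∫ ω in {ω | ∀ i ≤ n, ω i = w i}, (P.mulVec g) (ω n) ∂ν =
      ν.real {ω | ∀ i ≤ n, ω i = w i} * (P.mulVec g) (w n) := by
    rw [setIntegral_congr_fun (g := fun _ => (P.mulVec g) (w n)) (measurableSet_cylinder_le n w)
      (fun ω hω => congrArg (P.mulVec g) (hω n le_rfl)), setIntegral_const, smul_eq_mul]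
  have h2 : ∀ ω : ℕ → S, g (ω (n + 1)) =
      ∑ t, {ω : ℕ → S | ω (n + 1) = t}.indicator (fun _ => g t) ω := by
    intro ω
    simp [Set.indicator_apply]
  have hmeas := measurableSet_eval_eq (S := S) (n + 1)
  simp_rw [h2]
  rw [h1, integral_finsetSum _ fun t _ => (integrable_const (g t)).indicator (hmeas t)]
  simp_rw [integral_indicator_const _ (hmeas _), measureReal_restrict_apply (hmeas _),
    Set.inter_comm _ {ω : ℕ → S | ∀ i ≤ n, ω i = w i}, hν.measureReal_cylinder_inter hP,
    smul_eq_mul, Matrix.mulVec, dotProduct,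
    Finset.mul_sum, mul_assoc]
  exact sub_self _

/-- The Markov property in integrated form: `g (ω (n + 1)) - (P g) (ω n)` is orthogonal to every
function of the trajectory up to time `n`. -/
lemma IsTrajectoryLaw.integral_mul_eq_zero [IsProbabilityMeasure ν] (hν : IsTrajectoryLaw P ν s)
    (hP : IsStochastic P) (g : S → ℝ) {n : ℕ} {X : (ℕ → S) → ℝ} (hX : AdaptedAt n X) :
    ∫ ω, X ω * (g (ω (n + 1)) - (P.mulVec g) (ω n)) ∂ν = 0 := by
  have hY : Integrable (fun ω : ℕ → S => g (ω (n + 1)) - (P.mulVec g) (ω n)) ν :=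
    (integrable_comp_eval g _).sub (integrable_comp_eval (P.mulVec g) _)
  let e : (Fin (n + 1) → S) → ℕ → S := fun v i => if h : i < n + 1 then v ⟨i, h⟩ else s
  have hsum : ∀ ω : ℕ → S, X ω * (g (ω (n + 1)) - (P.mulVec g) (ω n)) =
      ∑ v : Fin (n + 1) → S, X (e v) * {ω : ℕ → S | ∀ i ≤ n, ω i = e v i}.indicator
        (fun ω => g (ω (n + 1)) - (P.mulVec g) (ω n)) ω := by
    intro ω
    have hω : ∀ i ≤ n, ω i = e (fun j => ω j) i := fun i hi => by
      rw [show e (fun j => ω j) i = ω i from dif_pos (Nat.lt_succ_of_le hi)]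
    rw [Finset.sum_eq_single (fun j : Fin (n + 1) => ω j)]
    · rw [Set.indicator_of_mem (by exact hω), ← hX _ _ hω]
    · intro v _ hv
      rw [Set.indicator_of_notMem, mul_zero]
      intro hmem
      refine hv (funext fun j => ?_)
      have := hmem j (Nat.le_of_lt_succ j.2)
      simpa only [e, dif_pos j.2] using this.symm
    · simp
  simp_rw [hsum]
  rw [integral_finsetSum _ fun v _ =>
    (hY.indicator (measurableSet_cylinder_le n (e v))).const_mul _]
  refine Finset.sum_eq_zero fun v _ => ?_
  rw [integral_const_mul, integral_indicator (measurableSet_cylinder_le n (e v)),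
    hν.setIntegral_cylinder hP, mul_zero]

lemma IsTrajectoryLaw.integral_eval [IsProbabilityMeasure ν] (hν : IsTrajectoryLaw P ν s)
    (hP : IsStochastic P) (n : ℕ) : ∀ f : S → ℝ, ∫ ω, f (ω n) ∂ν = ((P ^ n).mulVec f) s := by
  induction n with
  | zero =>
    intro f
    have h0 : ∀ᵐ ω ∂ν, f (ω 0) = f s := by
      have h1 : ν {ω | ω 0 = s} = 1 := by simpa using hν 0 fun _ => s
      have h2 : ∀ᵐ ω ∂ν, ω 0 = s :=
        (prob_compl_eq_zero_iff (measurableSet_eval_eq 0 s)).mpr h1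
      filter_upwards [h2] with ω hω
      rw [hω]
    rw [integral_congr_ae h0]
    simp
  | succ n ih =>
    intro f
    have h := hν.integral_mul_eq_zero hP f (n := n) (X := fun _ => 1) fun _ _ _ => rfl
    simp only [one_mul] at h
    rw [integral_sub (integrable_comp_eval f _) (integrable_comp_eval (P.mulVec f) _),
      sub_eq_zero] at h
    rw [h, ih, Matrix.mulVec_mulVec, pow_succ]

/-- A harmonic function is almost surely eventually constant along the trajectory. -/
lemma IsTrajectoryLaw.ae_exists_tendsto_of_harmonic [IsProbabilityMeasure ν]
    (hν : IsTrajectoryLaw P ν s) (hP : IsStochastic P) {h : S → ℝ} (hh : P.mulVec h = h) :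
    ∀ᵐ ω ∂ν, ∃ l, Tendsto (fun n => h (ω n)) atTop (𝓝 l) := by
  obtain ⟨C, hC0, hC⟩ := exists_forall_abs_le h
  have hsq_int : ∀ n, Integrable (fun ω : ℕ → S => h (ω n) ^ 2) ν :=
    fun n => integrable_comp_eval (fun t => h t ^ 2) n
  have hexp : ∀ (n : ℕ) (ω : ℕ → S), (h (ω (n + 1)) - h (ω n)) ^ 2 =
      h (ω (n + 1)) ^ 2 - h (ω n) ^ 2 - 2 * (h (ω n) * (h (ω (n + 1)) - h (ω n))) :=
    fun n ω => by ring
  have hcross_int : ∀ n, Integrable (fun ω : ℕ → S => h (ω n) * (h (ω (n + 1)) - h (ω n))) ν := by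
    intro n
    refine ((integrable_comp_eval h (n + 1)).sub (integrable_comp_eval h n)).bdd_mul (c := C)
      (measurable_comp_eval h n).aestronglyMeasurable (ae_of_all _ fun ω => hC _)
  have hint : ∀ n, Integrable (fun ω : ℕ → S => (h (ω (n + 1)) - h (ω n)) ^ 2) ν := by
    intro n
    simp_rw [hexp]
    exact ((hsq_int _).sub (hsq_int _)).sub ((hcross_int n).const_mul 2)
  have hval : ∀ n, ∫ ω, (h (ω (n + 1)) - h (ω n)) ^ 2 ∂ν =
      ∫ ω, h (ω (n + 1)) ^ 2 ∂ν - ∫ ω, h (ω n) ^ 2 ∂ν := by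
    intro n
    have h0 := hν.integral_mul_eq_zero hP h (n := n) (X := fun ω => h (ω n))
      fun ω ω' hω => congrArg h (hω n le_rfl)
    rw [hh] at h0
    simp_rw [hexp]
    rw [integral_sub (by exact (hsq_int _).sub (hsq_int _)) ((hcross_int n).const_mul 2),
      integral_sub (hsq_int _) (hsq_int _), integral_const_mul, h0, mul_zero, sub_zero]
  have hsum : Summable fun n => ∫ ω, (h (ω (n + 1)) - h (ω n)) ^ 2 ∂ν := by
    refine summable_of_sum_range_le (c := C ^ 2)
      (fun n => integral_nonneg fun ω => sq_nonneg _) fun n => ?_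
    simp_rw [hval]
    rw [Finset.sum_range_sub (fun n => ∫ ω, h (ω n) ^ 2 ∂ν)]
    have h1 : ∫ ω, h (ω n) ^ 2 ∂ν ≤ ∫ _ω : ℕ → S, C ^ 2 ∂ν :=
      integral_mono (hsq_int n) (integrable_const _) fun ω => sq_le_sq' (abs_le.mp (hC _)).1
        (abs_le.mp (hC _)).2
    have h2 : 0 ≤ ∫ ω, h (ω 0) ^ 2 ∂ν := integral_nonneg fun ω => sq_nonneg _
    simp at h1
    linarith
  filter_upwards [ae_tendsto_zero_of_summable_integral hint (fun _ _ => sq_nonneg _) hsum]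
    with ω hω
  have hfin : ((Set.range fun p : S × S => (h p.1 - h p.2) ^ 2) \ {0}).Finite :=
    (Set.finite_range _).subset Set.sdiff_subset
  have hev := hω.eventually (hfin.isClosed.isOpen_compl.mem_nhds (by simp))
  obtain ⟨N, hN⟩ := eventually_atTop.mp hev
  have hconst : ∀ n ≥ N, h (ω n) = h (ω N) := by
    intro n hn
    induction n, hn using Nat.le_induction with
    | base => rfl
    | succ n hn ih =>
      have hzero : (h (ω (n + 1)) - h (ω n)) ^ 2 = 0 := by
        by_contra hne
        exact hN n hn ⟨⟨(ω (n + 1), ω n), rfl⟩, hne⟩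
      rw [← ih]
      exact sub_eq_zero.mp (pow_eq_zero_iff two_ne_zero |>.mp hzero)
  exact ⟨h (ω N), tendsto_const_nhds.congr'
    (eventually_atTop.mpr ⟨N, fun n hn => (hconst n hn).symm⟩)⟩

/-- The strong law of large numbers for the martingale
`∑ i < n, (g (ω (i + 1)) - (P g) (ω i))`. -/
lemma IsTrajectoryLaw.ae_tendsto_martingale_div [IsProbabilityMeasure ν]
    (hν : IsTrajectoryLaw P ν s) (hP : IsStochastic P) (g : S → ℝ) :
    ∀ᵐ ω ∂ν, Tendsto
      (fun n : ℕ => (∑ i ∈ Finset.range n, (g (ω (i + 1)) - (P.mulVec g) (ω i))) / n)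
      atTop (𝓝 0) := by
  obtain ⟨C, hC0, hC⟩ := exists_forall_abs_le g
  set D : ℕ → (ℕ → S) → ℝ := fun i ω => g (ω (i + 1)) - (P.mulVec g) (ω i) with hD
  set M : ℕ → (ℕ → S) → ℝ := fun n ω => ∑ i ∈ Finset.range n, D i ω with hM
  have hDbound : ∀ i ω, |D i ω| ≤ 2 * C := fun i ω => by
    have := abs_sub (g (ω (i + 1))) ((P.mulVec g) (ω i))
    linarith [hC (ω (i + 1)), hP.abs_mulVec_le hC (ω i)]
  have hDmeas : ∀ i, Measurable (D i) := fun i =>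
    (measurable_comp_eval g _).sub (measurable_comp_eval (P.mulVec g) _)
  have hMmeas : ∀ n, Measurable (M n) := fun n => Finset.measurable_fun_sum _ fun i _ => hDmeas i
  have hMbound : ∀ n ω, |M n ω| ≤ n * (2 * C) := fun n ω => by
    calc |M n ω| ≤ ∑ i ∈ Finset.range n, |D i ω| := Finset.abs_sum_le_sum_abs _ _
      _ ≤ ∑ i ∈ Finset.range n, 2 * C := Finset.sum_le_sum fun i _ => hDbound i ω
      _ = n * (2 * C) := by simp
  have hMsq : ∀ n, Integrable (fun ω => M n ω ^ 2) ν := fun n => by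
    refine .of_bound ((hMmeas n).pow_const 2).aestronglyMeasurable ((n * (2 * C)) ^ 2)
      (ae_of_all _ fun ω => ?_)
    rw [Real.norm_eq_abs, abs_pow]
    exact pow_le_pow_left₀ (abs_nonneg _) (hMbound n ω) 2
  have hDsq : ∀ n ω, D n ω ^ 2 ≤ (2 * C) ^ 2 := fun n ω =>
    sq_le_sq' (abs_le.mp (hDbound n ω)).1 (abs_le.mp (hDbound n ω)).2
  have hcross_int : ∀ n, Integrable (fun ω => M n ω * D n ω) ν := fun n => by
    refine .of_bound ((hMmeas n).mul (hDmeas n)).aestronglyMeasurable (n * (2 * C) * (2 * C))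
      (ae_of_all _ fun ω => ?_)
    rw [Real.norm_eq_abs, abs_mul]
    exact mul_le_mul (hMbound n ω) (hDbound n ω) (abs_nonneg _) (by positivity)
  have hcross : ∀ n, ∫ ω, M n ω * D n ω ∂ν = 0 := fun n => by
    refine hν.integral_mul_eq_zero hP g fun ω ω' hω => ?_
    refine Finset.sum_congr rfl fun i hi => ?_
    have := Finset.mem_range.mp hi
    simp only [hD]
    rw [hω i (by omega), hω (i + 1) (by omega)]
  have hvar : ∀ n : ℕ, ∫ ω, M n ω ^ 2 ∂ν ≤ n * (2 * C) ^ 2 := by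
    intro n
    induction n with
    | zero => simp [hM]
    | succ n ih =>
      have hle : ∫ ω, M (n + 1) ω ^ 2 ∂ν ≤
          ∫ ω, (M n ω ^ 2 + 2 * (M n ω * D n ω) + (2 * C) ^ 2) ∂ν := by
        refine integral_mono (hMsq _)
          (((hMsq n).add ((hcross_int n).const_mul 2)).add (integrable_const _)) fun ω => ?_
        have : M (n + 1) ω = M n ω + D n ω := Finset.sum_range_succ _ _
        simp only [this]
        nlinarith [hDsq n ω]
      rw [integral_add (by exact (hMsq n).add ((hcross_int n).const_mul 2)) (integrable_const _),
        integral_add (hMsq n) ((hcross_int n).const_mul 2), integral_const_mul, hcross] at hle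
      simp at hle
      push_cast
      linarith
  have hscaled : ∀ k : ℕ, Integrable (fun ω => (M ((k + 1) ^ 2) ω / ((k + 1) ^ 2 : ℕ)) ^ 2) ν :=
    fun k => by
      simp_rw [div_pow]
      exact (hMsq _).div_const _
  have hsum : Summable fun k : ℕ => ∫ ω, (M ((k + 1) ^ 2) ω / ((k + 1) ^ 2 : ℕ)) ^ 2 ∂ν := by
    have hbase : Summable fun k : ℕ => (2 * C) ^ 2 * (1 / ((k + 1 : ℕ) : ℝ) ^ 2) :=
      ((summable_nat_add_iff 1).mpr
        (Real.summable_one_div_nat_pow.mpr one_lt_two)).mul_left _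
    refine Summable.of_nonneg_of_le (fun k => integral_nonneg fun ω => sq_nonneg _)
      (fun k => ?_) hbase
    simp_rw [div_pow]
    rw [integral_div, div_le_iff₀ (by positivity)]
    refine (hvar _).trans_eq ?_
    push_cast
    field_simp
  filter_upwards [ae_tendsto_zero_of_summable_integral hscaled (fun _ _ => sq_nonneg _) hsum]
    with ω hω
  refine tendsto_div_zero_of_tendsto_along_squares (K := 2 * C) (fun n => ?_) ?_
  · rw [Finset.sum_range_succ, add_sub_cancel_left]
    exact hDbound n ω
  · have := hω.sqrt
    simp_rw [Real.sqrt_sq_eq_abs, Real.sqrt_zero] at this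
    exact (tendsto_zero_iff_abs_tendsto_zero _).mpr this

/-- The running averages of a reward along the trajectory converge almost surely. -/
lemma IsTrajectoryLaw.ae_exists_tendsto_average [IsProbabilityMeasure ν]
    (hν : IsTrajectoryLaw P ν s) (hP : IsStochastic P) (r : S → ℝ) :
    ∀ᵐ ω ∂ν, ∃ l, Tendsto (fun n : ℕ => (n : ℝ)⁻¹ * ∑ i ∈ Finset.Icc 1 n, r (ω i))
      atTop (𝓝 l) := by
  obtain ⟨h, g, hh, hr⟩ := hP.exists_poisson_decomposition r
  obtain ⟨C, hC0, hC⟩ := exists_forall_abs_le (P.mulVec g)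
  filter_upwards [hν.ae_exists_tendsto_of_harmonic hP hh, hν.ae_tendsto_martingale_div hP g]
    with ω ⟨l, hl⟩ hmart
  have hces := ((tendsto_add_atTop_iff_nat 1).mpr hl).cesaro
  have hbdry : Tendsto (fun n : ℕ => ((P.mulVec g) (ω 0) - (P.mulVec g) (ω n)) / n)
      atTop (𝓝 0) := by
    refine squeeze_zero_norm (a := fun n : ℕ => 2 * C / n) (fun n => ?_)
      (tendsto_const_div_atTop_nhds_zero_nat _)
    rw [norm_div, Real.norm_eq_abs, Real.norm_natCast]
    have := abs_sub ((P.mulVec g) (ω 0)) ((P.mulVec g) (ω n))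
    gcongr
    linarith [hC (ω 0), hC (ω n)]
  refine ⟨l + 0 + 0, ((hces.add hmart).add hbdry).congr fun n => ?_⟩
  rw [sum_Icc_one_eq_sum_range, ← Finset.sum_range_sub' (fun i => (P.mulVec g) (ω i)),
    div_eq_inv_mul, div_eq_inv_mul, ← mul_add, ← mul_add, ← Finset.sum_add_distrib,
    ← Finset.sum_add_distrib]
  congr 1
  refine Finset.sum_congr rfl fun i _ => ?_
  have : r (ω (i + 1)) = h (ω (i + 1)) + (g (ω (i + 1)) - (P.mulVec g) (ω (i + 1))) :=
    congrFun hr _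
  rw [this]
  ring

end Trajectories

/-- The expected mean payoff of a reward function `r` equals the reward averaged
by the stationary distribution:
`E_{ℙ_s}[liminf_n (1/n) ∑_{i=1}^n r(ω i)] = ∑_{s'} π_s(s') · r(s')`.
The measure `μ s` is the canonical trajectory measure started at `s`
(characterized on cylinder sets) and `π` is the Cesàro-limit stationary
distribution. -/
theorem stmt8 {S : Type*} [Fintype S] [DecidableEq S] [Nonempty S]
    [MeasurableSpace S] [MeasurableSingletonClass S]
    (P : Matrix S S ℝ) (hP : IsStochastic P)
    (μ : S → Measure (ℕ → S)) (hμ : ∀ s, IsProbabilityMeasure (μ s))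
    (hcyl : ∀ (s : S) (n : ℕ) (w : ℕ → S),
      μ s {ω | ∀ i ≤ n, ω i = w i} =
        (if w 0 = s then 1 else 0) *
          ∏ i ∈ Finset.range n, ENNReal.ofReal (P (w i) (w (i + 1))))
    (π : S → S → ℝ)
    (hπ : ∀ sinit s : S,
      Tendsto (fun n : ℕ => (n : ℝ)⁻¹ * ∑ i ∈ Finset.Icc 1 n, (P ^ i) sinit s)
        atTop (𝓝 (π sinit s)))
    (r : S → ℝ) (s : S) :
    ∫ ω, liminf (fun n : ℕ => (n : ℝ)⁻¹ * ∑ i ∈ Finset.Icc 1 n, r (ω i)) atTop ∂(μ s)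
      = ∑ s', π s s' * r s' := by
  have hν : IsTrajectoryLaw P (μ s) s := hcyl s
  have := hμ s
  obtain ⟨C, hC0, hC⟩ := exists_forall_abs_le r
  have hint : ∀ n : ℕ, ∫ ω, (n : ℝ)⁻¹ * ∑ i ∈ Finset.Icc 1 n, r (ω i) ∂(μ s) =
      ∑ s', ((n : ℝ)⁻¹ * ∑ i ∈ Finset.Icc 1 n, (P ^ i) s s') * r s' := by
    intro n
    rw [integral_const_mul, integral_finsetSum _ fun i _ => integrable_comp_eval r i]
    simp_rw [hν.integral_eval hP, Matrix.mulVec, dotProduct, mul_assoc, Finset.sum_mul,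
      ← Finset.mul_sum]
    rw [Finset.sum_comm]
  have hlim : Tendsto (fun n : ℕ => ∫ ω, (n : ℝ)⁻¹ * ∑ i ∈ Finset.Icc 1 n, r (ω i) ∂(μ s))
      atTop (𝓝 (∑ s', π s s' * r s')) := by
    simp_rw [hint]
    exact tendsto_finsetSum _ fun s' _ => (hπ s s').mul_const _
  refine tendsto_nhds_unique (tendsto_integral_of_dominated_convergence (fun _ => C)
    (fun n => ?_) (integrable_const _) (fun n => ae_of_all _ fun ω => ?_) ?_) hlim
  · exact ((Finset.measurable_fun_sum _ fun i _ =>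
      measurable_comp_eval r i).const_mul _).aestronglyMeasurable
  · rw [norm_mul, norm_inv, Real.norm_natCast, Real.norm_eq_abs]
    have hsum : |∑ i ∈ Finset.Icc 1 n, r (ω i)| ≤ n * C :=
      calc |∑ i ∈ Finset.Icc 1 n, r (ω i)| ≤ ∑ i ∈ Finset.Icc 1 n, |r (ω i)| :=
            Finset.abs_sum_le_sum_abs _ _
        _ ≤ ∑ i ∈ Finset.Icc 1 n, C := Finset.sum_le_sum fun i _ => hC _
        _ = n * C := by simp
    rcases Nat.eq_zero_or_pos n with rfl | hn
    · simpa using hC0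
    · have hn' : (0 : ℝ) < n := by exact_mod_cast hn
      rwa [inv_mul_le_iff₀ hn']
  · filter_upwards [hν.ae_exists_tendsto_average hP r] with ω ⟨l, hl⟩
    rwa [hl.liminf_eq]
end

section
/- Let (S, P) be a finite Markov chain with initial state ŝ. Suppose that for every bottom strongly connected component R of (S,P) we are given numbers l^{◇R}, u^{◇R} ∈ ℝ with 0 ≤ l^{◇R} ≤ reach(ŝ,R) ≤ u^{◇R}, and functions l^R, u^R : R → ℝ with 0 ≤ l^R(s) ≤ π_R(s) ≤ u^R(s) for all s ∈ R. Then for every state s ∈ S, Σ_{R ∈ BSCCs(S,P)} l^{◇R} · l^R(s) ≤ π_ŝ(s) ≤ Σ_{R ∈ BSCCs(S,P)} u^{◇R} · u^R(s), where l^R and u^R are extended by 0 to states outside R. -/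
open Finset Filter Topology

/-- `R` is a bottom strongly connected component of the transition graph of `P`:
a nonempty, maximal strongly connected set of states with no transitions leaving it. -/
def IsBSCC {S : Type*} [Fintype S] (P : Matrix S S ℝ) (R : Finset S) : Prop :=
  R.Nonempty ∧
  (∀ a ∈ R, ∀ b ∈ R, Relation.ReflTransGen (fun x y => 0 < P x y) a b) ∧
  (∀ C : Finset S, R ⊆ C →
    (∀ a ∈ C, ∀ b ∈ C, Relation.ReflTransGen (fun x y => 0 < P x y) a b) → C = R) ∧
  (∀ s ∈ R, ∀ s' ∉ R, P s s' = 0)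

/-- Along transitions, positivity of a nonnegative function stationary on a closed set `R`
propagates. -/
lemma pos_of_reflTransGen_of_stationary {S : Type*} [Fintype S] {P : Matrix S S ℝ}
    (hP : IsStochastic P) {R : Finset S} (hR : ∀ s ∈ R, ∀ t ∉ R, P s t = 0) {f : S → ℝ}
    (hf : ∀ s ∈ R, 0 ≤ f s) (hst : ∀ t ∈ R, ∑ s ∈ R, f s * P s t = f t) {a b : S}
    (hab : Relation.ReflTransGen (fun x y => 0 < P x y) a b) (ha : a ∈ R) (hfa : 0 < f a) :
    b ∈ R ∧ 0 < f b := by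
  induction hab with
  | refl => exact ⟨ha, hfa⟩
  | @tail x y _ hxy ih =>
    obtain ⟨hx, hfx⟩ := ih
    have hy : y ∈ R := by
      by_contra hy
      exact hxy.ne' (hR x hx y hy)
    refine ⟨hy, ?_⟩
    rw [← hst y hy]
    exact (mul_pos hfx hxy).trans_le (Finset.single_le_sum
      (f := fun s => f s * P s y) (fun s hs => mul_nonneg (hf s hs) (hP.1 s y)) hx)

/-- A closed set of states contains everything reachable from it. -/
lemma mem_of_reflTransGen_of_closed {S : Type*} {P : Matrix S S ℝ} {R : Finset S}
    (hR : ∀ s ∈ R, ∀ t ∉ R, P s t = 0) {a b : S}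
    (hab : Relation.ReflTransGen (fun x y => 0 < P x y) a b) (ha : a ∈ R) : b ∈ R := by
  induction hab with
  | refl => exact ha
  | @tail x y _ hxy hx =>
    by_contra hy
    exact hxy.ne' (hR x hx y hy)

/-- Two bottom strongly connected components sharing a state coincide. -/
lemma IsBSCC.eq_of_mem {S : Type*} [Fintype S] {P : Matrix S S ℝ} {R R' : Finset S}
    (hR : IsBSCC P R) (hR' : IsBSCC P R') {s : S} (hs : s ∈ R) (hs' : s ∈ R') : R = R' := by
  ext b
  exact ⟨fun hb => mem_of_reflTransGen_of_closed hR'.2.2.2 (hR.2.1 s hs b hb) hs',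
    fun hb => mem_of_reflTransGen_of_closed hR.2.2.2 (hR'.2.1 s hs' b hb) hs⟩

/-- A stationary nonnegative vector carries no flow into a closed set from outside. -/
lemma mul_eq_zero_of_stationary_of_closed {S : Type*} [Fintype S] [DecidableEq S]
    {P : Matrix S S ℝ} (hP : IsStochastic P) {μ : S → ℝ} (hμ : ∀ s, 0 ≤ μ s)
    (hst : ∀ t, ∑ s, μ s * P s t = μ t) {D : Finset S}
    (hD : ∀ s ∈ D, ∀ t ∉ D, P s t = 0) {x y : S} (hx : x ∉ D) (hy : y ∈ D) :
    μ x * P x y = 0 := by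
  have hin : ∀ s ∈ D, ∑ t ∈ D, P s t = 1 := fun s hs => by
    rw [← hP.2 s]
    exact Finset.sum_subset (Finset.subset_univ D) fun t _ ht => hD s hs t ht
  have htotal : ∑ s, ∑ t ∈ D, μ s * P s t = ∑ t ∈ D, μ t := by
    rw [Finset.sum_comm]
    exact Finset.sum_congr rfl fun t _ => hst t
  have hinner : ∑ s ∈ D, ∑ t ∈ D, μ s * P s t = ∑ s ∈ D, μ s :=
    Finset.sum_congr rfl fun s hs => by rw [← Finset.mul_sum, hin s hs, mul_one]
  have hout : ∑ s ∈ Dᶜ, ∑ t ∈ D, μ s * P s t = 0 := by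
    have := Finset.sum_add_sum_compl D fun s => ∑ t ∈ D, μ s * P s t
    linarith
  have hnn : ∀ s t, 0 ≤ μ s * P s t := fun s t => mul_nonneg (hμ s) (hP.1 s t)
  have hx0 := (Finset.sum_eq_zero_iff_of_nonneg
    fun s _ => Finset.sum_nonneg fun t _ => hnn s t).1 hout x (Finset.mem_compl.2 hx)
  exact (Finset.sum_eq_zero_iff_of_nonneg fun t _ => hnn x t).1 hx0 y hy

/-- Every state charged by a stationary nonnegative vector lies in a bottom strongly
connected component. -/
lemma exists_isBSCC_of_stationary_pos {S : Type*} [Fintype S] [DecidableEq S]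
    {P : Matrix S S ℝ} (hP : IsStochastic P) {μ : S → ℝ} (hμ : ∀ s, 0 ≤ μ s)
    (hst : ∀ t, ∑ s, μ s * P s t = μ t) {s : S} (hs : 0 < μ s) :
    ∃ R, IsBSCC P R ∧ s ∈ R := by
  classical
  let E : S → S → Prop := fun x y => 0 < P x y
  let D : S → Finset S := fun a => Finset.univ.filter fun b => Relation.ReflTransGen E a b
  have hmem : ∀ a b, b ∈ D a ↔ Relation.ReflTransGen E a b := fun a b => by simp [D]
  have hclosed : ∀ a, ∀ x ∈ D a, ∀ y ∉ D a, P x y = 0 := fun a x hx y hy => by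
    by_contra hne
    exact hy ((hmem a y).2 (((hmem a x).1 hx).tail ((hP.1 x y).lt_of_ne' hne)))
  have hpos : ∀ x, Relation.ReflTransGen E s x → 0 < μ x := fun x hx =>
    (pos_of_reflTransGen_of_stationary hP (R := Finset.univ) (by simp) (fun t _ => hμ t)
      (fun t _ => hst t) hx (Finset.mem_univ _) hs).2
  have hback : ∀ t, Relation.ReflTransGen E s t → Relation.ReflTransGen E t s := by
    intro t hstt
    by_contra hts
    have hstay : ∀ x, Relation.ReflTransGen E s x → x ∉ D t := by
      intro x hx
      induction hx with
      | refl => exact fun h => hts ((hmem t s).1 h)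
      | @tail x y hsx hxy ih =>
        intro hy
        exact (mul_pos (hpos x hsx) hxy).ne'
          (mul_eq_zero_of_stationary_of_closed hP hμ hst (hclosed t) ih hy)
    exact hstay t hstt ((hmem t t).2 .refl)
  have hsD : s ∈ D s := (hmem s s).2 .refl
  refine ⟨D s, ⟨⟨s, hsD⟩, fun a ha b hb => ?_, fun C hC hcon => ?_, hclosed s⟩, hsD⟩
  · exact (hback a ((hmem s a).1 ha)).trans ((hmem s b).1 hb)
  · exact Finset.Subset.antisymm (fun c hc => (hmem s c).2 (hcon s (hC hsD) c hc)) hC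

/-- On a closed strongly connected set, every nonnegative stationary function is its total
mass times the stationary probability vector. -/
lemma eq_sum_mul_of_stationary {S : Type*} [Fintype S] {P : Matrix S S ℝ}
    (hP : IsStochastic P) {R : Finset S} (hR : IsBSCC P R) {ρ μ : S → ℝ}
    (hρ : ∀ s ∈ R, 0 ≤ ρ s) (hρ1 : ∑ s ∈ R, ρ s = 1)
    (hρst : ∀ t ∈ R, ∑ s ∈ R, ρ s * P s t = ρ t)
    (hμst : ∀ t ∈ R, ∑ s ∈ R, μ s * P s t = μ t) {s : S} (hs : s ∈ R) :
    μ s = (∑ t ∈ R, μ t) * ρ s := by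
  obtain ⟨hne, hcon, -, hclosed⟩ := hR
  have hρpos : ∀ t ∈ R, 0 < ρ t := by
    obtain ⟨a, ha, hρa⟩ := (Finset.sum_pos_iff_of_nonneg hρ).1 (hρ1 ▸ one_pos)
    exact fun t ht => (pos_of_reflTransGen_of_stationary hP hclosed hρ hρst
      (hcon a ha t ht) ha hρa).2
  obtain ⟨m, hm, hmin⟩ := R.exists_min_image (fun t => μ t / ρ t) hne
  set c := μ m / ρ m with hc
  have hνnn : ∀ t ∈ R, 0 ≤ μ t - c * ρ t := fun t ht =>
    sub_nonneg.2 ((le_div_iff₀ (hρpos t ht)).1 (hmin t ht))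
  have hνst : ∀ t ∈ R, ∑ s ∈ R, (μ s - c * ρ s) * P s t = μ t - c * ρ t := fun t ht => by
    simp_rw [sub_mul, Finset.sum_sub_distrib, mul_assoc, ← Finset.mul_sum, hμst t ht, hρst t ht]
  have heq : ∀ t ∈ R, μ t = c * ρ t := fun t ht => by
    by_contra hne
    have h := (pos_of_reflTransGen_of_stationary hP hclosed hνnn hνst (hcon t ht m hm) ht
      ((hνnn t ht).lt_of_ne' (sub_ne_zero.2 hne))).2
    rw [hc, div_mul_cancel₀ _ (hρpos m hm).ne', sub_self] at h
    exact h.false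
  rw [Finset.sum_congr rfl heq, ← Finset.mul_sum, hρ1, mul_one, heq s hs]

/-- Powers of a stochastic matrix are stochastic. -/
lemma IsStochastic.pow {S : Type*} [Fintype S] [DecidableEq S] {P : Matrix S S ℝ}
    (hP : IsStochastic P) (n : ℕ) : IsStochastic (P ^ n) := by
  have hmem : P ∈ Matrix.rowStochastic ℝ S :=
    Matrix.mem_rowStochastic_iff_sum.2 hP
  exact Matrix.mem_rowStochastic_iff_sum.1 (pow_mem hmem n)

/-- A Cesàro limit of the powers of a stochastic matrix is stationary. -/
lemma stationary_of_tendsto_cesaro {S : Type*} [Fintype S] [DecidableEq S] {P : Matrix S S ℝ}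
    (hP : IsStochastic P) {a : S} {μ : S → ℝ}
    (hμ : ∀ s, Tendsto (fun n : ℕ => (n : ℝ)⁻¹ * ∑ i ∈ Finset.Icc 1 n, (P ^ i) a s)
      atTop (𝓝 (μ s))) (t : S) : ∑ s, μ s * P s t = μ t := by
  have hdiff : ∀ n : ℕ,
      ∑ s, ((n : ℝ)⁻¹ * ∑ i ∈ Finset.Icc 1 n, (P ^ i) a s) * P s t
        = (n : ℝ)⁻¹ * ∑ i ∈ Finset.Icc 1 n, (P ^ i) a t
          + (n : ℝ)⁻¹ * ((P ^ (n + 1)) a t - P a t) := by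
    intro n
    have htel : ∑ i ∈ Finset.Icc 1 n, (P ^ (i + 1)) a t
        = ∑ i ∈ Finset.Icc 1 n, (P ^ i) a t + ((P ^ (n + 1)) a t - P a t) := by
      induction n with
      | zero => simp
      | succ k ih =>
        rw [Finset.sum_Icc_succ_top (by omega), Finset.sum_Icc_succ_top (by omega), ih]
        ring
    have hstep : ∑ s, (∑ i ∈ Finset.Icc 1 n, (P ^ i) a s) * P s t
        = ∑ i ∈ Finset.Icc 1 n, (P ^ (i + 1)) a t := by
      simp_rw [Finset.sum_mul]
      rw [Finset.sum_comm]
      exact Finset.sum_congr rfl fun i _ => by rw [pow_succ, Matrix.mul_apply]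
    simp_rw [mul_assoc, ← Finset.mul_sum]
    rw [hstep, htel, mul_add]
  have hle : ∀ n, |(P ^ n) a t| ≤ 1 := fun n => by
    rw [abs_of_nonneg ((hP.pow n).1 a t), ← (hP.pow n).2 a]
    exact Finset.single_le_sum (fun s _ => (hP.pow n).1 a s) (Finset.mem_univ t)
  have hzero : Tendsto (fun n : ℕ => (n : ℝ)⁻¹ * ((P ^ (n + 1)) a t - P a t)) atTop (𝓝 0) := by
    refine tendsto_inv_atTop_nhds_zero_nat.zero_mul_isBoundedUnder_le ?_
    refine isBoundedUnder_of ⟨2, fun n => ?_⟩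
    have h1 := hle 1
    rw [pow_one] at h1
    have := abs_sub ((P ^ (n + 1)) a t) (P a t)
    have := hle (n + 1)
    simp only [Function.comp_apply, Real.norm_eq_abs]
    linarith
  have hlim := tendsto_finsetSum Finset.univ fun s _ => (hμ s).mul_const (P s t)
  simp_rw [hdiff] at hlim
  simpa using tendsto_nhds_unique hlim ((hμ t).add hzero)

/-- The Cesàro limit gives a set the limiting probability of being in that set. -/
lemma sum_eq_of_tendsto_cesaro {S : Type*} [Fintype S] [DecidableEq S] {P : Matrix S S ℝ}
    {a : S} {μ : S → ℝ}
    (hμ : ∀ s, Tendsto (fun n : ℕ => (n : ℝ)⁻¹ * ∑ i ∈ Finset.Icc 1 n, (P ^ i) a s)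
      atTop (𝓝 (μ s))) {R : Finset S} {r : ℝ}
    (hr : Tendsto (fun n : ℕ => ∑ t ∈ R, (P ^ n) a t) atTop (𝓝 r)) :
    ∑ t ∈ R, μ t = r := by
  refine tendsto_nhds_unique (tendsto_finsetSum R fun s _ => hμ s) ?_
  refine ((tendsto_add_atTop_iff_nat 1).2 hr).cesaro.congr fun n => ?_
  rw [← Finset.mul_sum, Finset.sum_comm (s := R), Finset.range_eq_Ico,
    Finset.sum_Ico_add' (fun i => ∑ t ∈ R, (P ^ i) a t) 0 n 1, zero_add,
    Finset.Ico_add_one_right_eq_Icc]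

open scoped Classical in
/-- Bounds via BSCC decomposition: if for every BSCC `R` we have numbers
`ld R ≤ reach(sinit,R) ≤ ud R` (with `0 ≤ ld R`) and functions
`lR R ≤ π_R ≤ uR R` on `R` (with `0 ≤ lR R`, extended by `0` outside `R`), then
`∑_R ld R · lR R s ≤ π sinit s ≤ ∑_R ud R · uR R s` for every state `s`. -/
theorem stmt10 {S : Type*} [Fintype S] [DecidableEq S] [Nonempty S]
    (P : Matrix S S ℝ) (hP : IsStochastic P) (sinit : S)
    (π : S → S → ℝ)
    (hπ : ∀ sinit' s : S,
      Tendsto (fun n : ℕ => (n : ℝ)⁻¹ * ∑ i ∈ Finset.Icc 1 n, (P ^ i) sinit' s)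
        atTop (𝓝 (π sinit' s)))
    (reach : S → Finset S → ℝ)
    (hreach : ∀ (s : S) (R : Finset S), IsBSCC P R →
      Tendsto (fun n : ℕ => ∑ t ∈ R, (P ^ n) s t) atTop (𝓝 (reach s R)))
    (πR : Finset S → S → ℝ)
    (hπR : ∀ R : Finset S, IsBSCC P R →
      (∀ s, 0 ≤ πR R s) ∧ (∀ s ∉ R, πR R s = 0) ∧ (∑ s ∈ R, πR R s = 1) ∧
      (∀ t ∈ R, ∑ s ∈ R, πR R s * P s t = πR R t))
    (ld ud : Finset S → ℝ) (lR uR : Finset S → S → ℝ)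
    (hreachBounds : ∀ R : Finset S, IsBSCC P R →
      0 ≤ ld R ∧ ld R ≤ reach sinit R ∧ reach sinit R ≤ ud R)
    (hdistBounds : ∀ R : Finset S, IsBSCC P R → ∀ s ∈ R,
      0 ≤ lR R s ∧ lR R s ≤ πR R s ∧ πR R s ≤ uR R s)
    (hext : ∀ (R : Finset S), ∀ s ∉ R, lR R s = 0 ∧ uR R s = 0) :
    ∀ s : S,
      ∑ R ∈ Finset.univ.filter (fun R : Finset S => IsBSCC P R), ld R * lR R s
          ≤ π sinit s ∧
      π sinit s ≤
        ∑ R ∈ Finset.univ.filter (fun R : Finset S => IsBSCC P R), ud R * uR R s := by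
  have hst := stationary_of_tendsto_cesaro hP (hπ sinit)
  have hnn : ∀ s, 0 ≤ π sinit s := fun s => ge_of_tendsto' (hπ sinit s) fun n =>
    mul_nonneg (by positivity) (Finset.sum_nonneg fun i _ => (hP.pow i).1 sinit s)
  have hdecomp : ∀ s, π sinit s =
      ∑ R ∈ Finset.univ.filter (fun R : Finset S => IsBSCC P R), reach sinit R * πR R s := by
    intro s
    by_cases h : ∃ R, IsBSCC P R ∧ s ∈ R
    · obtain ⟨R, hR, hs⟩ := h
      rw [Finset.sum_eq_single_of_mem R (by simpa using hR)]
      · have hRst : ∀ t ∈ R, ∑ x ∈ R, π sinit x * P x t = π sinit t := fun t ht => by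
          rw [← hst t]
          exact Finset.sum_subset (Finset.subset_univ R) fun x _ hx =>
            mul_eq_zero_of_stationary_of_closed hP hnn hst hR.2.2.2 hx ht
        obtain ⟨h0, -, h1, hinv⟩ := hπR R hR
        rw [← sum_eq_of_tendsto_cesaro (hπ sinit) (hreach sinit R hR)]
        exact eq_sum_mul_of_stationary hP hR (fun x _ => h0 x) h1 hinv hRst hs
      · intro R' hR' hne
        have hR' := (Finset.mem_filter.1 hR').2
        rw [(hπR R' hR').2.1 s fun hs' => hne (hR'.eq_of_mem hR hs' hs), mul_zero]
    · rw [Finset.sum_eq_zero]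
      · by_contra hne
        exact h (exists_isBSCC_of_stationary_pos hP hnn hst ((hnn s).lt_of_ne' hne))
      · intro R hR
        have hR := (Finset.mem_filter.1 hR).2
        rw [(hπR R hR).2.1 s fun hs => h ⟨R, hR, hs⟩, mul_zero]
  intro s
  rw [hdecomp s]
  constructor <;> refine Finset.sum_le_sum fun R hR => ?_ <;>
    have hR := (Finset.mem_filter.1 hR).2 <;>
    obtain ⟨hl0, hl, hu⟩ := hreachBounds R hR <;>
    by_cases hs : s ∈ R
  · obtain ⟨hd0, hd, -⟩ := hdistBounds R hR s hs
    exact mul_le_mul hl hd hd0 (hl0.trans hl)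
  · simp [(hext R s hs).1, (hπR R hR).2.1 s hs]
  · exact mul_le_mul hu (hdistBounds R hR s hs).2.2 ((hπR R hR).1 s) ((hl0.trans hl).trans hu)
  · simp [(hext R s hs).2, (hπR R hR).2.1 s hs]
end

section
/- Let (S, P) be a finite Markov chain and r : S → ℝ a reward function. Define the gain of a state by gain_r(s) := Σ_{s'∈S} π_s(s') · r(s'). Fix any initial vector v₀ : S → ℝ and define the value iteration v_{n+1}(s) = r(s) + Σ_{s'∈S} P(s,s') v_n(s') and the differences Δ_n(s) = v_{n+1}(s) − v_n(s). Then for every n ∈ ℕ and every state s ∈ S: min_{s'∈S} Δ_n(s') ≤ gain_r(s) ≤ max_{s'∈S} Δ_n(s'). -/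
open Finset Filter Topology

namespace IsStochastic

variable {S : Type*} [Fintype S] {P : Matrix S S ℝ}

lemma le_one (hP : IsStochastic P) (s s' : S) : P s s' ≤ 1 := by
  rw [← hP.2 s]
  exact Finset.single_le_sum (fun t _ => hP.1 s t) (Finset.mem_univ s')

variable [DecidableEq S]

lemma pow_s14 (hP : IsStochastic P) (n : ℕ) : IsStochastic (P ^ n) := by
  induction n with
  | zero =>
    refine ⟨fun s s' => ?_, fun s => by simp [Matrix.one_apply]⟩
    rw [pow_zero, Matrix.one_apply]
    split_ifs <;> norm_num
  | succ n ih =>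
    refine ⟨fun s s' => ?_, fun s => ?_⟩
    · rw [pow_succ, Matrix.mul_apply]
      exact Finset.sum_nonneg fun t _ => mul_nonneg (ih.1 s t) (hP.1 t s')
    · simp_rw [pow_succ, Matrix.mul_apply]
      rw [Finset.sum_comm]
      simp_rw [← Finset.mul_sum, hP.2, mul_one]
      exact ih.2 s

/-- Cesàro limits of the powers of a stochastic matrix are nonnegative. -/
lemma cesaro_nonneg (hP : IsStochastic P) {s t : S} {a : ℝ}
    (h : Tendsto (fun n : ℕ => (n : ℝ)⁻¹ * ∑ i ∈ Finset.Icc 1 n, (P ^ i) s t) atTop (𝓝 a)) :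
    0 ≤ a :=
  ge_of_tendsto' h fun n => mul_nonneg (by positivity)
    (Finset.sum_nonneg fun i _ => (hP.pow_s14 i).1 s t)

/-- Cesàro limits of the rows of the powers of a stochastic matrix have total mass one. -/
lemma cesaro_sum_eq_one (hP : IsStochastic P) {s : S} {p : S → ℝ}
    (h : ∀ t, Tendsto (fun n : ℕ => (n : ℝ)⁻¹ * ∑ i ∈ Finset.Icc 1 n, (P ^ i) s t)
      atTop (𝓝 (p t))) :
    ∑ t, p t = 1 := by
  refine tendsto_nhds_unique (tendsto_finsetSum Finset.univ fun t _ => h t) ?_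
  refine tendsto_const_nhds.congr' ?_
  filter_upwards [eventually_gt_atTop 0] with n hn
  have hn' : (n : ℝ) ≠ 0 := by positivity
  rw [← Finset.mul_sum, Finset.sum_comm, Finset.sum_congr rfl fun i _ => (hP.pow_s14 i).2 s]
  simp [hn']

/-- Cesàro limits of the rows of the powers of a stochastic matrix are invariant. -/
lemma cesaro_invariant (hP : IsStochastic P) {s : S} {p : S → ℝ}
    (h : ∀ t, Tendsto (fun n : ℕ => (n : ℝ)⁻¹ * ∑ i ∈ Finset.Icc 1 n, (P ^ i) s t)
      atTop (𝓝 (p t))) (t : S) :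
    ∑ u, p u * P u t = p t := by
  refine tendsto_nhds_unique
    (tendsto_finsetSum Finset.univ fun u _ => (h u).mul_const (P u t)) ?_
  have key : ∀ n : ℕ, ∑ u, (n : ℝ)⁻¹ * (∑ i ∈ Finset.Icc 1 n, (P ^ i) s u) * P u t
      = (n : ℝ)⁻¹ * (∑ i ∈ Finset.Icc 1 n, (P ^ i) s t)
        + (n : ℝ)⁻¹ * ((P ^ (n + 1)) s t - P s t) := by
    intro n
    have shift : ∑ i ∈ Finset.Icc 1 n, (P ^ (i + 1)) s t
        = ∑ i ∈ Finset.Icc 1 n, (P ^ i) s t + ((P ^ (n + 1)) s t - P s t) := by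
      induction n with
      | zero => simp
      | succ n ih =>
        rw [Finset.sum_Icc_succ_top (by omega), Finset.sum_Icc_succ_top (by omega), ih]
        ring
    rw [← mul_add, ← shift]
    simp_rw [mul_assoc, Finset.sum_mul]
    rw [← Finset.mul_sum, Finset.sum_comm]
    simp_rw [pow_succ, Matrix.mul_apply]
  simp_rw [key]
  have hzero : Tendsto (fun n : ℕ => (n : ℝ)⁻¹ * ((P ^ (n + 1)) s t - P s t)) atTop (𝓝 0) := by
    refine squeeze_zero_norm (fun n => ?_) (tendsto_inv_atTop_nhds_zero_nat (𝕜 := ℝ))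
    have hdiff : |(P ^ (n + 1)) s t - P s t| ≤ 1 := by
      rw [abs_le]
      constructor <;>
        linarith [(hP.pow_s14 (n + 1)).1 s t, (hP.pow_s14 (n + 1)).le_one s t, hP.1 s t, hP.le_one s t]
    rw [Real.norm_eq_abs, abs_mul, abs_of_nonneg (by positivity : (0 : ℝ) ≤ (n : ℝ)⁻¹)]
    exact mul_le_of_le_one_right (by positivity) hdiff
  simpa using (h t).add hzero

end IsStochastic

/-- Value iteration bounds for the gain (mean payoff): with
`v (n+1) s = r s + ∑_{s'} P s s' · v n s'` (arbitrary `v 0`) and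
`Δ_n(s) = v (n+1) s - v n s`, for every `n` and every state `s` the gain
`gain_r(s) = ∑_{s'} π s s' · r s'` satisfies
`min_{s'} Δ_n(s') ≤ gain_r(s) ≤ max_{s'} Δ_n(s')`.
Here `π` is the Cesàro-limit stationary distribution. -/
theorem stmt14 {S : Type*} [Fintype S] [DecidableEq S] [Nonempty S]
    (P : Matrix S S ℝ) (hP : IsStochastic P)
    (π : S → S → ℝ)
    (hπ : ∀ sinit s : S,
      Tendsto (fun n : ℕ => (n : ℝ)⁻¹ * ∑ i ∈ Finset.Icc 1 n, (P ^ i) sinit s)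
        atTop (𝓝 (π sinit s)))
    (r : S → ℝ)
    (v : ℕ → S → ℝ)
    (hv : ∀ (n : ℕ) (s : S), v (n + 1) s = r s + ∑ s', P s s' * v n s') :
    ∀ (n : ℕ) (s : S),
      (Finset.univ.inf' Finset.univ_nonempty fun s' => v (n + 1) s' - v n s')
          ≤ ∑ s', π s s' * r s' ∧
      ∑ s', π s s' * r s' ≤
        Finset.univ.sup' Finset.univ_nonempty fun s' => v (n + 1) s' - v n s' := by
  intro n s
  have hnonneg : ∀ t, 0 ≤ π s t := fun t => hP.cesaro_nonneg (hπ s t)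
  have hone : ∑ t, π s t = 1 := hP.cesaro_sum_eq_one (hπ s)
  have hinv := hP.cesaro_invariant (hπ s)
  have hgain : ∑ t, π s t * r t = ∑ t, π s t * (v (n + 1) t - v n t) := by
    have hPv : ∑ t, π s t * ∑ u, P t u * v n u = ∑ u, π s u * v n u := by
      simp_rw [Finset.mul_sum, ← mul_assoc]
      rw [Finset.sum_comm]
      simp_rw [← Finset.sum_mul, hinv]
    simp_rw [hv n, mul_sub, mul_add, Finset.sum_sub_distrib, Finset.sum_add_distrib, hPv]
    ring
  rw [hgain]
  constructor
  · calc _ = ∑ t, π s t * Finset.univ.inf' Finset.univ_nonempty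
          (fun s' => v (n + 1) s' - v n s') := by rw [← Finset.sum_mul, hone, one_mul]
      _ ≤ _ := Finset.sum_le_sum fun t _ => mul_le_mul_of_nonneg_left
          (Finset.inf'_le _ (Finset.mem_univ t)) (hnonneg t)
  · calc _ ≤ ∑ t, π s t * Finset.univ.sup' Finset.univ_nonempty
          (fun s' => v (n + 1) s' - v n s') :=
          Finset.sum_le_sum fun t _ => mul_le_mul_of_nonneg_left
            (Finset.le_sup' (fun s' => v (n + 1) s' - v n s') (Finset.mem_univ t)) (hnonneg t)
      _ = _ := by rw [← Finset.sum_mul, hone, one_mul]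
end
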